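/- Let n ≥ 1, let a₁, a₂, a₃ ∈ ℤ/2, and set x̃ := x + a₁·x·v + a₂·x^{2n+1}·w + a₃·x^{2n+1}·v·w in R. Then the ℤ/2-algebra homomorphism from (ℤ/2)[X,V,W]/(X^{2n+2}, V² + (n+1)X^{2n}W) to R determined by X ↦ x̃, V ↦ v, W ↦ w is well defined and is an isomorphism of ℤ/2-algebras. -/

import Mathlib

open MvPolynomial

noncomputable section

/-- The polynomial ring `(ℤ/2)[x,v,w]`. -/
abbrev P : Type := MvPolynomial (Fin 3) (ZMod 2)

/-- The ideal `(x^{2n+2}, v² + (n+1)·x^{2n}·w)` (the coefficient `n+1` read mod 2). -/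
def relIdeal (n : ℕ) : Ideal P :=
  Ideal.span {(X 0 : P) ^ (2 * n + 2),
    (X 1 : P) ^ 2 + C ((n : ZMod 2) + 1) * (X 0 : P) ^ (2 * n) * X 2}

/-- `R = (ℤ/2)[x,v,w]/(x^{2n+2}, v² + (n+1)x^{2n}w) ≅ ℍ_*(L ℝP^{2n+1}; ℤ/2)`. -/
abbrev R (n : ℕ) : Type := P ⧸ relIdeal n

/-- The quotient map as a `ℤ/2`-algebra homomorphism. -/
def mkR (n : ℕ) : P →ₐ[ZMod 2] R n := Ideal.Quotient.mkₐ (ZMod 2) (relIdeal n)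

def x (n : ℕ) : R n := mkR n (X 0)
def v (n : ℕ) : R n := mkR n (X 1)
def w (n : ℕ) : R n := mkR n (X 2)

theorem two_eq_zero (n : ℕ) : (2 : R n) = 0 := by
  have h := congrArg (algebraMap (ZMod 2) (R n)) (show (2 : ZMod 2) = 0 from rfl)
  rwa [map_zero, map_ofNat] at h

theorem x_pow_eq_zero (n : ℕ) : x n ^ (2 * n + 2) = 0 := by
  have h : mkR n (X 0 ^ (2 * n + 2)) = 0 :=
    Ideal.Quotient.eq_zero_iff_mem.mpr (Ideal.subset_span (by simp))
  rwa [map_pow] at h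

theorem mkR_C (n : ℕ) (a : ZMod 2) : mkR n (C a) = algebraMap (ZMod 2) (R n) a :=
  (mkR n).commutes a

theorem v_sq_add (n : ℕ) :
    v n ^ 2 + algebraMap (ZMod 2) (R n) ((n : ZMod 2) + 1) * x n ^ (2 * n) * w n = 0 := by
  have h : mkR n (X 1 ^ 2 + C ((n : ZMod 2) + 1) * X 0 ^ (2 * n) * X 2) = 0 :=
    Ideal.Quotient.eq_zero_iff_mem.mpr (Ideal.subset_span (by simp))
  rwa [map_add, map_mul, map_mul, map_pow, map_pow, mkR_C] at h

/-- The universal property of the presentation of `R n`. -/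
theorem exists_algHom (n : ℕ) {A : Type*} [CommRing A] [Algebra (ZMod 2) A] (x' v' w' : A)
    (hx : x' ^ (2 * n + 2) = 0)
    (hv : v' ^ 2 + algebraMap (ZMod 2) A ((n : ZMod 2) + 1) * x' ^ (2 * n) * w' = 0) :
    ∃ f : R n →ₐ[ZMod 2] A, f (x n) = x' ∧ f (v n) = v' ∧ f (w n) = w' := by
  have h : relIdeal n ≤ RingHom.ker (aeval ![x', v', w'] : P →ₐ[ZMod 2] A) := by
    rw [relIdeal, Ideal.span_le]
    rintro p (rfl | rfl)
    · simpa [RingHom.mem_ker] using hx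
    · simpa [RingHom.mem_ker] using hv
  refine ⟨Ideal.Quotient.liftₐ (relIdeal n) (aeval ![x', v', w']) fun p hp => h hp, ?_, ?_, ?_⟩
  · exact (aeval_X (R := ZMod 2) ![x', v', w'] 0)
  · exact (aeval_X (R := ZMod 2) ![x', v', w'] 1)
  · exact (aeval_X (R := ZMod 2) ![x', v', w'] 2)

theorem algHom_ext_xvw (n : ℕ) {A : Type*} [CommRing A] [Algebra (ZMod 2) A]
    {f g : R n →ₐ[ZMod 2] A} (hx : f (x n) = g (x n)) (hv : f (v n) = g (v n))
    (hw : f (w n) = g (w n)) : f = g := by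
  apply Ideal.Quotient.algHom_ext
  apply MvPolynomial.algHom_ext
  intro i
  fin_cases i
  exacts [hx, hv, hw]

theorem mul_one_add_mul_pow {A : Type*} [CommRing A] {y : A} (hy : y * y = 0) (t : A) (k : ℕ) :
    y * (1 + y * t) ^ k = y := by
  induction k with
  | zero => simp
  | succ k ih =>
    rw [pow_succ, ← mul_assoc, ih]
    linear_combination t * hy

/-- The `ℤ/2`-algebra homomorphism from `(ℤ/2)[X,V,W]/(X^{2n+2}, V²+(n+1)X^{2n}W)`
to `R` determined by `X ↦ x̃`, `V ↦ v`, `W ↦ w` is well defined and an isomorphism;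
since the domain has the same presentation as `R`, this is an algebra automorphism of `R`
sending the generators `x, v, w` to `x̃, v, w`. -/
theorem stmt_7 (n : ℕ) (hn : 1 ≤ n) (a₁ a₂ a₃ : ZMod 2) (xt : R n)
    (hxt : xt = x n + a₁ • (x n * v n) + a₂ • (x n ^ (2 * n + 1) * w n)
      + a₃ • (x n ^ (2 * n + 1) * v n * w n)) :
    ∃ e : R n ≃ₐ[ZMod 2] R n, e (x n) = xt ∧ e (v n) = v n ∧ e (w n) = w n := by
  set α := algebraMap (ZMod 2) (R n) with hα
  set c := α ((n : ZMod 2) + 1) with hc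
  set y := x n ^ (2 * n) with hy
  have h2 := two_eq_zero n
  have hyy : y * y = 0 := by
    rw [hy, ← pow_add]
    exact pow_eq_zero_of_le (by omega) (x_pow_eq_zero n)
  have hv : v n ^ 2 + c * y * w n = 0 := v_sq_add n
  let u : R n := 1 + α a₁ * v n + y * (α a₂ * w n + α a₃ * v n * w n)
  have hsmul (a : ZMod 2) (r : R n) : a • r = α a * r := Algebra.smul_def a r
  have hxu : xt = x n * u := by
    simp only [hxt, hsmul, u, hy, pow_succ]
    ring
  have hu2 : u ^ 2 = 1 + y * (α a₁ ^ 2 * c * w n) := by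
    simp only [u]
    linear_combination α a₁ ^ 2 * hv + (α a₂ * w n + α a₃ * v n * w n) ^ 2 * hyy
      + (α a₁ * v n + (1 + α a₁ * v n) * y * (α a₂ * w n + α a₃ * v n * w n)
        - α a₁ ^ 2 * c * y * w n) * h2
  have hu4 : u ^ 4 = 1 := by
    linear_combination (u ^ 2 + 1 + y * (α a₁ ^ 2 * c * w n)) * hu2
      + (α a₁ ^ 2 * c * w n) ^ 2 * hyy + y * (α a₁ ^ 2 * c * w n) * h2
  have hxty : xt ^ (2 * n) = y := by
    rw [hxu, mul_pow, pow_mul u, hu2]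
    exact mul_one_add_mul_pow hyy _ n
  obtain ⟨f, fx, fv, fw⟩ := exists_algHom n xt (v n) (w n)
    (by rw [hxu, mul_pow, x_pow_eq_zero, zero_mul]) (by rw [hxty]; exact hv)
  have fu : f u = u := by
    simp only [u, hy, map_add, map_mul, map_pow, map_one, fx, fv, fw, hα, AlgHom.commutes, hxty]
  have hf4 : f (f (f (f (x n)))) = x n := by
    simp only [fx, hxu, map_mul, fu]
    linear_combination x n * hu4
  refine ⟨AlgEquiv.ofAlgHom f (f.comp (f.comp f)) ?_ ?_, fx, fv, fw⟩ <;>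
    exact algHom_ext_xvw n hf4 (by simp [fv]) (by simp [fw])

end
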